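/- Let k be a positive integer, and let G and G' be canonical plumbing graphs such that G occurs as an induced subgraph of G'. If G fails Property X_k, then G' fails Property X_k. -/

import Mathlib

namespace LensPaper

/-- A finite weighted simple graph: the combinatorial data underlying a configuration
(a disjoint union of weighted linear graphs).  The fact that every connected component
is a path is recorded separately by `Config.IsLinear`. -/
structure Config where
  V : Type
  fin : Fintype V
  deq : DecidableEq V
  graph : SimpleGraph V
  adjDec : DecidableRel graph.Adj
  w : V → ℤ

attribute [instance] Config.fin Config.deq Config.adjDec

namespace Config

/-- The degree of a vertex. -/
noncomputable def deg (C : Config) (v : C.V) : ℕ := (C.graph.neighborSet v).ncard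

/-- A configuration: every component is a path, i.e. all degrees are at most `2` and the
graph is acyclic. -/
def IsLinear (C : Config) : Prop :=
  (∀ v : C.V, C.deg v ≤ 2) ∧ C.graph.IsAcyclic

/-- The adjusted weight `w'(v) = w(v) - deg(v)`. -/
noncomputable def adjw (C : Config) (v : C.V) : ℤ := C.w v - C.deg v

/-- A vertex is bad if it is adjacent to two distinct vertices of positive adjusted
weight. -/
def IsBad (C : Config) (x : C.V) : Prop :=
  ∃ u v : C.V, u ≠ v ∧ C.graph.Adj x u ∧ C.graph.Adj x v ∧ 0 < C.adjw u ∧ 0 < C.adjw v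

/-- A leaf: a vertex of degree at most one. -/
def IsLeaf (C : Config) (v : C.V) : Prop := C.deg v ≤ 1

/-- `v 0, v 1, …, v m` is a chain of consecutive (distinct) vertices. -/
def IsChain (C : Config) (m : ℕ) (v : ℕ → C.V) : Prop :=
  (∀ i ≤ m, ∀ j ≤ m, v i = v j → i = j) ∧ ∀ i < m, C.graph.Adj (v i) (v (i + 1))

/-- The chain `v 0, …, v m` has the list `p` as its sequence of adjusted weights. -/
def ChainPattern (C : Config) (m : ℕ) (v : ℕ → C.V) (p : List ℤ) : Prop :=
  C.IsChain m v ∧ m + 1 = p.length ∧ ∀ i : Fin p.length, C.adjw (v i) = p.get i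

/-- `Γ` contains a chain of consecutive vertices whose adjusted weights, read in order,
form the list `p`. -/
def HasPattern (C : Config) (p : List ℤ) : Prop := ∃ m v, C.ChainPattern m v p

/-- A chain realizing a bad-part pattern `p` (each entry of `p` is an adjusted weight
together with a flag marking the bad positions): the chain has the prescribed adjusted
weights, and the bad vertices of the configuration are exactly the vertices of the chain
in the flagged positions. -/
def IsBadPartChain (C : Config) (p : List (ℤ × Bool)) (m : ℕ) (v : ℕ → C.V) : Prop :=
  C.IsChain m v ∧ m + 1 = p.length ∧
  (∀ i : Fin p.length, C.adjw (v i) = (p.get i).1) ∧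
  (∀ x : C.V, C.IsBad x ↔ ∃ i : Fin p.length, (p.get i).2 = true ∧ v i = x)

end Config

/-- The chains of adjusted weights forbidden by Working Condition VI. -/
def forbiddenPatterns : List (List ℤ) :=
  [[1, 0, 0, 2], [1, 0, 0, 3], [1, 0, 0, 0, 3], [1, 1, 0, 0, 1, 2], [3, 1, 0, 0, 1],
   [1, 0, 1, 2], [1, 0, 1, 3], [1, 1, 0, 2], [1, 1, 0, 1, 1, 2]]

/-- The bad-part patterns of Working Condition VII; `true` marks the bad positions. -/
def badPatterns : List (List (ℤ × Bool)) :=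
  [[(1, false), (0, true), (1, false)],
   [(1, false), (0, true), (2, false)],
   [(1, false), (0, true), (3, false)],
   [(1, false), (1, true), (1, false)],
   [(1, false), (1, true), (2, false)],
   [(1, false), (2, true), (1, false)],
   [(1, false), (0, true), (1, false), (0, true), (1, false)],
   [(1, false), (0, true), (1, false), (0, true), (2, false)],
   [(1, false), (0, true), (1, false), (1, true), (1, false)],
   [(1, false), (0, true), (1, false), (1, true), (2, false)],
   [(1, false), (1, true), (1, true), (1, false)],
   [(1, false), (1, true), (1, true), (1, true), (1, false)],
   [(1, false), (1, true), (2, true), (1, false)]]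

namespace Config

/-- The Working Conditions (I)–(VII). -/
def WorkingConditions (C : Config) : Prop :=
  (∀ v : C.V, 2 ≤ C.w v) ∧
  (∀ v : C.V, C.adjw v ≤ 3) ∧
  (∀ u v : C.V, 1 < C.adjw u → 1 < C.adjw v → u = v) ∧
  (∀ v x : C.V, 1 < C.adjw v → C.IsBad x → C.adjw x = 1 → C.graph.Adj x v) ∧
  ((∃ v : C.V, C.adjw v = 3) →
     ∀ u u' : C.V, C.graph.Adj u u' → C.adjw u = 1 → C.adjw u' = 1 → False) ∧
  (∀ u v x : C.V, C.graph.Adj u v → C.adjw u = 1 → C.adjw v = 1 →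
     C.IsBad x → C.adjw x = 2 → C.graph.Adj x u ∨ C.graph.Adj x v) ∧
  (∀ p ∈ forbiddenPatterns, ¬ C.HasPattern p) ∧
  ((∃ x : C.V, C.IsBad x) → ∃ p ∈ badPatterns, ∃ m v, C.IsBadPartChain p m v)

end Config

/-- The standard inner product on `ℤ^N`. -/
def dot {N : ℕ} (x y : Fin N → ℤ) : ℤ := ∑ i, x i * y i

/-- The support of a vector of `ℤ^N` with respect to the standard orthonormal basis. -/
def supp {N : ℕ} (x : Fin N → ℤ) : Finset (Fin N) :=
  Finset.univ.filter fun i => x i ≠ 0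

namespace Config

/-- An embedding of a configuration into `ℤ^N`. -/
def IsEmbedding (C : Config) (N : ℕ) (φ : C.V → Fin N → ℤ) : Prop :=
  ∀ u v : C.V, dot (φ u) (φ v) =
    if u = v then C.w u else if C.graph.Adj u v then -1 else 0

/-- The restriction of `φ` to `S` is standard. -/
def IsStandardOn (C : Config) (N : ℕ) (φ : C.V → Fin N → ℤ) (S : Set C.V) : Prop :=
  ∀ u ∈ S, ∀ v ∈ S,
    ((supp (φ u) ∩ supp (φ v)).card : ℤ) =
      if u = v then C.w v else if C.graph.Adj u v then 1 else 0

/-- A standard embedding. -/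
def IsStandard (C : Config) (N : ℕ) (φ : C.V → Fin N → ℤ) : Prop :=
  C.IsStandardOn N φ Set.univ

/-- The restriction of `φ` to `S` is semi-standard at `x`. -/
def IsSemiStandardAtOn (C : Config) (N : ℕ) (φ : C.V → Fin N → ℤ) (x : C.V)
    (S : Set C.V) : Prop :=
  (∀ u ∈ S, ∀ v ∈ S,
    ((supp (φ u) ∩ supp (φ v)).card : ℤ) =
      if u = v then C.w v
      else if C.graph.Adj u v then 1
      else if C.graph.Adj x u ∧ C.graph.Adj x v then 2
      else 0) ∧
  (∀ u ∈ S, ∀ v ∈ S, u ≠ v → C.graph.Adj x u → C.graph.Adj x v →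
    (supp (φ u) ∩ supp (φ x) ∩ supp (φ v)).card = 1)

/-- A semi-standard embedding: semi-standard at some bad vertex. -/
def IsSemiStandard (C : Config) (N : ℕ) (φ : C.V → Fin N → ℤ) : Prop :=
  ∃ x : C.V, C.IsBad x ∧ C.IsSemiStandardAtOn N φ x Set.univ

/-- A candidate for the extended bad part: a chain containing the bad part whose two
ends are either leaves or preceded by two consecutive vertices of vanishing adjusted
weight. -/
def IsEBPCand (C : Config) (m : ℕ) (v : ℕ → C.V) : Prop :=
  C.IsChain m v ∧
  (∀ p ∈ badPatterns, ∀ mb vb, C.IsBadPartChain p mb vb →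
     ∀ i ≤ mb, ∃ j ≤ m, v j = vb i) ∧
  (C.IsLeaf (v 0) ∨ (2 ≤ m ∧ C.adjw (v 1) = 0 ∧ C.adjw (v 2) = 0)) ∧
  (C.IsLeaf (v m) ∨ (2 ≤ m ∧ C.adjw (v (m - 1)) = 0 ∧ C.adjw (v (m - 2)) = 0))

/-- The extended bad part: a candidate with the fewest vertices. -/
def IsExtBadPart (C : Config) (m : ℕ) (v : ℕ → C.V) : Prop :=
  C.IsEBPCand m v ∧ ∀ m' v', C.IsEBPCand m' v' → m ≤ m'

/-- The set of vertices of the chain `v 0, …, v m`. -/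
def ebpSet (C : Config) (m : ℕ) (v : ℕ → C.V) : Set C.V := {y | ∃ i ≤ m, v i = y}

/-- The outside part of `Γ` relative to the extended bad part `v 0, …, v m`. -/
def OutsidePart (C : Config) (m : ℕ) (v : ℕ → C.V) : Set C.V :=
  {x | ∀ i ≤ m, v i ≠ x}
  ∪ {x | ¬ C.IsLeaf (v 0) ∧ (x = v 0 ∨ x = v 1 ∨ x = v 2)}
  ∪ {x | ¬ C.IsLeaf (v m) ∧ (x = v m ∨ x = v (m - 1) ∨ x = v (m - 2))}

/-- A screw at the front end of the extended bad part. -/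
def IsFrontScrew (C : Config) (N : ℕ) (φ : C.V → Fin N → ℤ) (m : ℕ) (v : ℕ → C.V)
    (e : Fin N) : Prop :=
  ¬ C.IsLeaf (v 0) ∧ 3 ≤ m ∧ φ (v 2) e ≠ 0 ∧ φ (v 3) e ≠ 0

/-- A screw at the back end of the extended bad part. -/
def IsBackScrew (C : Config) (N : ℕ) (φ : C.V → Fin N → ℤ) (m : ℕ) (v : ℕ → C.V)
    (e : Fin N) : Prop :=
  ¬ C.IsLeaf (v m) ∧ 3 ≤ m ∧ φ (v (m - 2)) e ≠ 0 ∧ φ (v (m - 3)) e ≠ 0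

/-- All screws of `Γ` (with respect to `φ`) are clean. -/
def AllScrewsClean (C : Config) (N : ℕ) (φ : C.V → Fin N → ℤ) (m : ℕ)
    (v : ℕ → C.V) : Prop :=
  (∀ e : Fin N, C.IsFrontScrew N φ m v e →
    ∀ u : C.V, u ≠ v 2 → u ≠ v 3 → φ u e = 0) ∧
  (∀ e : Fin N, C.IsBackScrew N φ m v e →
    ∀ u : C.V, u ≠ v (m - 2) → u ≠ v (m - 3) → φ u e = 0)

end Config
/-- The path graph on the disjoint union of the components encoded by a list of lists:
two vertices are adjacent iff they lie in the same component in consecutive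
positions. -/
def ofListGraph (L : List (List ℤ)) :
    SimpleGraph ((i : Fin L.length) × Fin (L.get i).length) where
  Adj a b := a.1 = b.1 ∧ ((a.2 : ℕ) + 1 = (b.2 : ℕ) ∨ (b.2 : ℕ) + 1 = (a.2 : ℕ))
  symm := ⟨fun a b h => ⟨h.1.symm, h.2.symm⟩⟩
  loopless := by
    constructor
    intro a h
    rcases h with ⟨-, h | h⟩ <;> omega

instance ofListGraphDec (L : List (List ℤ)) : DecidableRel (ofListGraph L).Adj :=
  fun a b => decidable_of_iff
    (a.1 = b.1 ∧ ((a.2 : ℕ) + 1 = (b.2 : ℕ) ∨ (b.2 : ℕ) + 1 = (a.2 : ℕ))) Iff.rfl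

/-- The configuration (disjoint union of weighted paths) encoded by a list of
components, each component being the list of its weights read along the path. -/
def ofList (L : List (List ℤ)) : Config where
  V := (i : Fin L.length) × Fin (L.get i).length
  fin := inferInstance
  deq := inferInstance
  graph := ofListGraph L
  adjDec := ofListGraphDec L
  w := fun a => (L.get a.1).get a.2

/-- `A` occurs as an induced subgraph of `B`: an injective, weight-preserving map
that preserves and reflects adjacency. -/
def IsInducedSubgraph (A B : Config) : Prop :=
  ∃ f : A.V → B.V, Function.Injective f ∧
    (∀ v, B.w (f v) = A.w v) ∧
    (∀ u v, A.graph.Adj u v ↔ B.graph.Adj (f u) (f v))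

/-- `A` is (isomorphic to) the subgraph of `B` induced by the vertex set `S`. -/
def IsInducedOn (A B : Config) (S : Set B.V) : Prop :=
  ∃ f : A.V → B.V, Function.Injective f ∧
    (∀ v, B.w (f v) = A.w v) ∧
    (∀ u v, A.graph.Adj u v ↔ B.graph.Adj (f u) (f v)) ∧
    Set.range f = S

/-- Negative continued fraction `[a₁,…,aₙ]⁻ = a₁ - 1/[a₂,…,aₙ]⁻` (the empty list is
sent to `0`; with the junk value `1/0 = 0` this gives `[aₙ]⁻ = aₙ`). -/
def negCF : List ℤ → ℚ
  | [] => 0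
  | a :: l => (a : ℚ) - 1 / negCF l

/-- The (positive) sequences `a` and `b` are dual: for some coprime `p > q > 0`,
`[a]⁻ = p/q` and `[b]⁻ = p/(p-q)`. -/
def DualSeqs (a b : List ℤ) : Prop :=
  a ≠ [] ∧ b ≠ [] ∧ (∀ x ∈ a, 2 ≤ x) ∧ (∀ x ∈ b, 2 ≤ x) ∧
  ∃ p q : ℤ, 0 < q ∧ q < p ∧ Int.gcd p q = 1 ∧
    negCF a = (p : ℚ) / (q : ℚ) ∧ negCF b = (p : ℚ) / ((p : ℚ) - (q : ℚ))

/-- `P` encodes a canonical plumbing graph (weights `≤ -2`) and `D` encodes its dual: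
the components correspond to each other and each pair of weight sequences is dual. -/
def IsDualPair (P D : List (List ℤ)) : Prop :=
  ∃ h : P.length = D.length,
    ∀ i : Fin P.length,
      DualSeqs ((P.get i).map fun x => -x) (D.get (Fin.cast h i))

/-- The total number of vertices encoded by a list of components. -/
def totalLen (L : List (List ℤ)) : ℕ := (L.map List.length).sum

/-- The canonical plumbing graph encoded by `P`, with dual encoded by `D`, fails
Property `X_k`: its dual admits an embedding into `ℤ^(n-k)`, where
`n = |V(G)| + |V(Γ)|`. -/
def FailsX (k : ℕ) (P D : List (List ℤ)) : Prop :=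
  k ≤ totalLen P + totalLen D ∧
  ∃ φ : (ofList D).V → Fin (totalLen P + totalLen D - k) → ℤ,
    (ofList D).IsEmbedding (totalLen P + totalLen D - k) φ

/-- The seventeen forbidden configurations of Theorem B (iii), encoded as lists of
path components. -/
def forbidden17 : List (List (List ℤ)) :=
  [[[-5, -2]], [[-6, -2, -2]], [[-2], [-2]], [[-3], [-2, -2]], [[-3, -2, -2, -3]],
   [[-3, -5, -3, -2]], [[-2, -2, -3, -5]], [[-4, -3, -2]], [[-3, -4, -2]],
   [[-4, -4, -2, -2]], [[-3, -4, -3, -3, -2]], [[-3, -3], [-2]], [[-3, -2, -3], [-3]],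
   [[-4], [-4]], [[-4], [-3, -3]], [[-4], [-3, -2, -3]], [[-3, -3], [-3, -3]]]

namespace Config

/-- A shallow vertex of a canonical plumbing graph. -/
def IsShallow (C : Config) (v : C.V) : Prop :=
  C.w v = -2 ∨ C.w v = -4 ∨
  (C.w v = -3 ∧ ∃ u, C.graph.Adj v u ∧ C.w u = -2) ∨
  (C.w v = -3 ∧ ∃ u, C.graph.Adj v u ∧ C.w u = -3)

/-- A deep vertex of a canonical plumbing graph. -/
def IsDeep (C : Config) (v : C.V) : Prop :=
  (5 ≤ |C.w v| ∧ ∀ u, C.graph.Adj v u → ¬ C.IsShallow u) ∨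
  (C.w v = -3 ∧ ∀ u, ¬ C.graph.Adj v u)

end Config

/-! ### Lists representing disjoint unions of paths with respect to a form -/

section Rep

variable {T T' : Type*} (B : T → T → ℤ)

/-- `a` pairs to `-1` with the head of the list and to `0` with its other members. -/
def Row (a : T) : List T → Prop
  | [] => True
  | h :: t => B a h = -1 ∧ ∀ y ∈ t, B a y = 0

/-- Consecutive members of the list pair to `-1`, all other pairs of members to `0`. -/
def Lin : List T → Prop
  | [] => True
  | a :: t => Row B a t ∧ Lin t

/-- The members of `c` are orthogonal to the members of `d`. -/
def Orth (c d : List T) : Prop := ∀ x ∈ c, ∀ y ∈ d, B x y = 0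

/-- A list of mutually orthogonal linear chains. -/
def Rep (W : List (List T)) : Prop := (∀ c ∈ W, Lin B c) ∧ W.Pairwise (Orth B)

variable {B}

theorem row_append (a x : T) (u v : List T) :
    Row B a (u ++ x :: v) ↔ Row B a (u ++ [x]) ∧ ∀ y ∈ v, B a y = 0 := by
  cases u with
  | nil => simp [Row]
  | cons h t => simp only [List.cons_append, Row, List.mem_append, List.mem_cons]; grind

theorem lin_append (x : T) (u v : List T) :
    Lin B (u ++ x :: v) ↔
      Lin B (u ++ [x]) ∧ Lin B (x :: v) ∧ ∀ a ∈ u, ∀ b ∈ v, B a b = 0 := by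
  induction u with
  | nil => simp [Lin, Row]
  | cons a u ih =>
    simp only [List.cons_append, Lin]
    rw [row_append, ih]
    simp only [List.mem_cons, forall_eq_or_imp, Lin]
    tauto

theorem row_of_lin_append {x : T} {u v : List T} (h : Lin B (u ++ x :: v)) : Row B x v :=
  ((lin_append x u v).1 h).2.1.1

theorem Lin.of_append_right {u v : List T} (h : Lin B (u ++ v)) : Lin B v := by
  induction u with
  | nil => exact h
  | cons a u ih => exact ih h.2

theorem Lin.of_append_left {u v : List T} (h : Lin B (u ++ v)) : Lin B u := by
  induction u with
  | nil => trivial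
  | cons a u ih =>
    refine ⟨?_, ih h.2⟩
    have := h.1
    cases u with
    | nil => trivial
    | cons b u => exact ⟨this.1, fun y hy => this.2 y (by simp [hy])⟩

theorem Lin.reverse (hs : ∀ a b, B a b = B b a) {c : List T} (h : Lin B c) :
    Lin B c.reverse := by
  induction c with
  | nil => trivial
  | cons a t ih =>
    cases t with
    | nil => exact h
    | cons b t =>
      have h2 := ih h.2
      rw [List.reverse_cons, List.reverse_cons, List.append_assoc, List.singleton_append,
        lin_append]
      rw [List.reverse_cons] at h2
      refine ⟨h2, ⟨⟨by rw [hs]; exact h.1.1, by simp⟩, trivial, trivial⟩, ?_⟩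
      intro x hx y hy
      rw [List.mem_singleton] at hy
      rw [hy, hs]
      exact h.1.2 x (by simpa using hx)

theorem Lin.congr_head {q q' : T} {Y : List T} (h : Lin B (q :: Y))
    (hq : ∀ b ∈ Y, B q' b = B q b) : Lin B (q' :: Y) := by
  refine ⟨?_, h.2⟩
  have := h.1
  cases Y with
  | nil => trivial
  | cons y Y => exact ⟨by rw [hq y (by simp)]; exact this.1,
      fun z hz => by rw [hq z (by simp [hz])]; exact this.2 z hz⟩

theorem Lin.congr_last {p p' : T} {X : List T} (h : Lin B (X ++ [p]))
    (hp : ∀ a ∈ X, B a p' = B a p) : Lin B (X ++ [p']) := by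
  induction X with
  | nil => exact ⟨trivial, trivial⟩
  | cons a X ih =>
    refine ⟨?_, ih h.2 fun a ha => hp a (by simp [ha])⟩
    have h1 := h.1
    have h2 := hp a (by simp)
    cases X with
    | nil => exact ⟨by rw [h2]; exact h1.1, by simp⟩
    | cons b X =>
      refine ⟨h1.1, fun y hy => ?_⟩
      have h3 : ∀ y ∈ X ++ [p], B a y = 0 := h1.2
      replace hy : y ∈ X ++ [p'] := hy
      simp only [List.mem_append, List.mem_singleton] at h3 hy
      rcases hy with hy | rfl
      · exact h3 y (Or.inl hy)
      · rw [h2]; exact h3 p (Or.inr rfl)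

theorem Lin.map {B' : T' → T' → ℤ} {g : T → T'} (hg : ∀ x y, B' (g x) (g y) = B x y)
    {c : List T} (h : Lin B c) : Lin B' (c.map g) := by
  induction c with
  | nil => trivial
  | cons a t ih =>
    refine ⟨?_, ih h.2⟩
    have := h.1
    cases t with
    | nil => trivial
    | cons b t =>
      refine ⟨by rw [hg]; exact this.1, fun y hy => ?_⟩
      obtain ⟨z, hz, rfl⟩ := List.mem_map.1 hy
      rw [hg]; exact this.2 z hz

theorem Orth.symm (hs : ∀ a b, B a b = B b a) {c d : List T} (h : Orth B c d) :
    Orth B d c := fun x hx y hy => by rw [hs]; exact h y hy x hx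

theorem Rep.map {B' : T' → T' → ℤ} {g : T → T'} (hg : ∀ x y, B' (g x) (g y) = B x y)
    {W : List (List T)} (h : Rep B W) : Rep B' (W.map (List.map g)) := by
  refine ⟨fun c hc => ?_, ?_⟩
  · obtain ⟨d, hd, rfl⟩ := List.mem_map.1 hc
    exact (h.1 d hd).map hg
  · rw [List.pairwise_map]
    refine h.2.imp fun {c d} hcd x hx y hy => ?_
    obtain ⟨x', hx', rfl⟩ := List.mem_map.1 hx
    obtain ⟨y', hy', rfl⟩ := List.mem_map.1 hy
    rw [hg]; exact hcd x' hx' y' hy'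

theorem rep_cons {c : List T} {W : List (List T)} :
    Rep B (c :: W) ↔ Lin B c ∧ (∀ d ∈ W, Orth B c d) ∧ Rep B W := by
  simp only [Rep, List.mem_cons, forall_eq_or_imp, List.pairwise_cons]
  tauto

theorem Rep.perm (hs : ∀ a b, B a b = B b a) {W W' : List (List T)} (h : W.Perm W')
    (hW : Rep B W) : Rep B W' :=
  ⟨fun c hc => hW.1 c (h.mem_iff.2 hc), (h.pairwise_iff fun h => h.symm hs).1 hW.2⟩

theorem lin_iff_getElem {l : List T} :
    Lin B l ↔ ∀ i j (hi : i < l.length) (hj : j < l.length), i < j →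
      B l[i] l[j] = if i + 1 = j then -1 else 0 := by
  induction l with
  | nil => simp [Lin]
  | cons a t ih =>
    rw [Lin, ih]
    constructor
    · rintro ⟨h1, h2⟩ i j hi hj hij
      obtain ⟨j, rfl⟩ : ∃ j', j = j' + 1 := ⟨j - 1, by omega⟩
      cases i with
      | succ i => simpa using h2 i j (by simpa using hi) (by simpa using hj) (by omega)
      | zero =>
        cases t with
        | nil => simp at hj
        | cons b t =>
          cases j with
          | zero => simpa using h1.1
          | succ j => simpa using h1.2 _ (List.getElem_mem _)
    · intro h
      constructor
      · cases t with
        | nil => trivial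
        | cons b t =>
          refine ⟨(h 0 1 (by simp) (by simp) (by omega)).trans (if_pos rfl), fun y hy => ?_⟩
          obtain ⟨j, hj, rfl⟩ := List.getElem_of_mem hy
          exact (h 0 (j + 2) (by simp) (by simpa using hj) (by omega)).trans (if_neg (by omega))
      · intro i j hi hj hij
        have := h (i + 1) (j + 1) (by simpa using hi) (by simpa using hj) (by omega)
        simp only [add_left_inj] at this
        exact this

end Rep

/-! ### Growing a family of paths inside a larger family of paths -/

section Grow

variable {V : Type*}

/-- A property of lists of paths which does not depend on the order and the orientations
of the components, nor on empty components, and which is inherited when an additional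
vertex joins two (possibly empty) components. -/
structure GrowClosed (F : List (List V) → Prop) : Prop where
  perm : ∀ {A A'}, A.Perm A' → F A → F A'
  reverse : ∀ {c A}, F (c :: A) → F (c.reverse :: A)
  nil_iff : ∀ {A}, F ([] :: A) ↔ F A
  insert : ∀ {u x v A}, F (u :: v :: A) → F ((u ++ x :: v) :: A)

variable {F : List (List V) → Prop} {B : V → V → ℤ}

theorem GrowClosed.append_left (hF : GrowClosed F) (A C : List (List V)) (h : F C) :
    F (A ++ C) := by
  induction A with
  | nil => exact h
  | cons a A ih =>
    induction a with
    | nil => exact hF.nil_iff.2 ih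
    | cons x a iha => exact hF.insert (u := []) (hF.nil_iff.2 iha)

theorem Rep.exists_infix (hF : GrowClosed F) (hs : ∀ a b, B a b = B b a)
    (h0 : ∀ a, B a a ≠ 0) (h1 : ∀ a, B a a ≠ -1) {W : List (List V)} (hW : Rep B W)
    {c : List V} (hc : Lin B c) (hne : c ≠ []) (hsub : ∀ x ∈ c, x ∈ W.flatten) :
    ∃ u v R, Rep B ((u ++ c ++ v) :: R) ∧
      (∀ x ∈ W.flatten, x ∈ ((u ++ c ++ v) :: R).flatten) ∧
      ∀ C, F ((u ++ c ++ v) :: R ++ C) → F (W ++ C) := by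
  induction c with
  | nil => exact absurd rfl hne
  | cons x c ih =>
    have hx := hsub x (by simp)
    cases c with
    | nil =>
      obtain ⟨l, hl, hxl⟩ := List.mem_flatten.1 hx
      obtain ⟨R₁, R₂, rfl⟩ := List.append_of_mem hl
      have hR := List.perm_middle (a := l) (l₁ := R₁) (l₂ := R₂)
      obtain ⟨u, v, rfl⟩ := List.append_of_mem hxl
      refine ⟨u, v, R₁ ++ R₂, ?_, ?_, ?_⟩
      · simpa using hW.perm hs hR
      · intro y hy
        simpa using hR.flatten.mem_iff.1 hy
      · intro C hC
        refine hF.perm (hR.symm.append_right C) ?_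
        simpa using hC
    | cons y t =>
      obtain ⟨u, v, R, hM, hmem, hFM⟩ :=
        ih hc.2 (by simp) fun z hz => hsub z (List.mem_cons_of_mem _ hz)
      have hxy : B x y = -1 := hc.1.1
      have hyx : B y x = -1 := by rw [hs]; exact hxy
      have hL := (rep_cons.1 hM).1
      have hxM := hmem x hx
      simp only [List.flatten_cons, List.mem_append, List.mem_cons] at hxM
      rcases hxM with ((hxu | hxy' | hxt) | hxv) | hxR
      · obtain ⟨u1, u2, rfl⟩ := List.append_of_mem hxu
        have hrow : Row B x (u2 ++ y :: (t ++ v)) :=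
          row_of_lin_append (u := u1) (by simpa using hL)
        cases u2 with
        | nil => exact ⟨u1, v, R, by simpa using hM, by simpa using hmem, by simpa using hFM⟩
        | cons z u2 =>
          have := hrow.2 y (by simp)
          omega
      · rw [hxy'] at hxy
        exact absurd hxy (h1 y)
      · exact absurd (hc.1.2 x hxt) (h0 x)
      · obtain ⟨v1, v2, rfl⟩ := List.append_of_mem hxv
        have hrow : Row B y ((t ++ v1) ++ x :: v2) :=
          row_of_lin_append (u := u) (by simpa using hL)
        cases htv : t ++ v1 with
        | cons z s =>
          rw [htv] at hrow
          have := hrow.2 x (by simp)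
          omega
        | nil =>
          obtain ⟨rfl, rfl⟩ := List.append_eq_nil_iff.1 htv
          have hrev : v2.reverse ++ [x, y] ++ u.reverse
              = (u ++ [y] ++ ([] ++ x :: v2)).reverse := by simp
          rw [rep_cons] at hM
          refine ⟨v2.reverse, u.reverse, R, ?_, ?_, ?_⟩
          · rw [hrev, rep_cons]
            exact ⟨hM.1.reverse hs, fun d hd z hz => hM.2.1 d hd z (List.mem_reverse.1 hz),
              hM.2.2⟩
          · intro z hz
            have := hmem z hz
            rw [hrev]
            simp only [List.flatten_cons, List.mem_append, List.mem_reverse, List.mem_cons,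
              List.not_mem_nil, or_false, false_or] at this ⊢
            tauto
          · intro C hC
            rw [hrev] at hC
            apply hFM
            simpa using hF.reverse hC
      · obtain ⟨d, hd, hxd⟩ := List.mem_flatten.1 hxR
        have := (rep_cons.1 hM).2.1 d hd y (by simp) x hxd
        omega

theorem Rep.grow (hF : GrowClosed F) (hs : ∀ a b, B a b = B b a)
    (h0 : ∀ a, B a a ≠ 0) (h1 : ∀ a, B a a ≠ -1) {A : List (List V)} (hA : Rep B A)
    {W : List (List V)} (hW : Rep B W) (hsub : ∀ x ∈ A.flatten, x ∈ W.flatten)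
    {C : List (List V)} (h : F (A ++ C)) : F (W ++ C) := by
  induction A generalizing W C with
  | nil => exact hF.append_left W C h
  | cons c A ih =>
    obtain ⟨hcL, hcA, hA'⟩ := rep_cons.1 hA
    rcases eq_or_ne c [] with rfl | hne
    · exact ih hA' hW (by simpa using hsub) (hF.nil_iff.1 h)
    obtain ⟨u, v, R, hM, hmem, hFM⟩ := hW.exists_infix hF hs h0 h1 hcL hne
      fun x hx => hsub x (by simp [hx])
    obtain ⟨hL, hMR, hR⟩ := rep_cons.1 hM
    have notMem : ∀ x y, x ∈ c → B x y = -1 → y ∉ A.flatten := by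
      intro x y hx hxy hy
      obtain ⟨d, hd, hyd⟩ := List.mem_flatten.1 hy
      have := hcA d hd x hx y hyd
      omega
    obtain ⟨u', hu'L, hu'sub, hu'mem, hu'orth, hu'F⟩ : ∃ u', Lin B u' ∧ (∀ x ∈ u', x ∈ u) ∧
        (∀ x ∈ A.flatten, x ∈ u → x ∈ u') ∧ (∀ x ∈ u', ∀ y ∈ c ++ v, B x y = 0) ∧
        ∀ Z, F (u' :: (c ++ v) :: Z) → F ((u ++ c ++ v) :: Z) := by
      rcases List.eq_nil_or_concat u with rfl | ⟨u', x, rfl⟩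
      · exact ⟨[], trivial, by simp, by simp, by simp, fun Z hZ => hF.nil_iff.1 hZ⟩
      · simp only [List.concat_eq_append, List.append_assoc, List.singleton_append] at hL ⊢
        obtain ⟨ha, hb, hc⟩ := (lin_append x u' (c ++ v)).1 hL
        refine ⟨u', ha.of_append_left, by simp +contextual, ?_, hc, fun Z hZ => hF.insert hZ⟩
        intro y hyA hy
        rcases List.mem_append.1 hy with hy | hy
        · exact hy
        · rw [List.mem_singleton] at hy
          subst hy
          obtain ⟨z, t, rfl⟩ := List.exists_cons_of_ne_nil hne
          exact absurd hyA (notMem z y (by simp) (by rw [hs]; exact hb.1.1))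
    obtain ⟨v', hv'L, hv'sub, hv'mem, hv'F⟩ : ∃ v', Lin B v' ∧ (∀ x ∈ v', x ∈ v) ∧
        (∀ x ∈ A.flatten, x ∈ v → x ∈ v') ∧ ∀ Z, F (c :: v' :: Z) → F ((c ++ v) :: Z) := by
      cases v with
      | nil =>
        refine ⟨[], trivial, by simp, by simp, fun Z hZ => ?_⟩
        rw [List.append_nil]
        exact hF.nil_iff.1 (hF.perm (List.Perm.swap _ _ _) hZ)
      | cons x v' =>
        rw [List.append_assoc] at hL
        refine ⟨v', hL.of_append_right.of_append_right.2, by simp +contextual, ?_,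
          fun Z hZ => hF.insert hZ⟩
        intro y hyA hy
        rcases List.mem_cons.1 hy with rfl | hy
        · rcases List.eq_nil_or_concat c with rfl | ⟨t, z, rfl⟩
          · exact absurd rfl hne
          · have : Row B z (y :: v') :=
              row_of_lin_append (u := t) (by simpa using hL.of_append_right)
            exact absurd hyA (notMem z y (by simp) this.1)
        · exact hy
    apply hFM
    apply hu'F
    refine hF.perm (List.Perm.swap _ _ _) (hv'F _ ?_)
    refine hF.perm (A := u' :: v' :: R ++ c :: C) ?_ ?_
    · exact (List.perm_middle (l₁ := u' :: v' :: R)).trans ((List.Perm.swap _ _ _).cons c)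
    · refine ih hA' ?_ ?_ (hF.perm List.perm_middle.symm h)
      · rw [rep_cons, rep_cons]
        refine ⟨hu'L, ?_, hv'L, ?_, hR⟩
        · intro d hd x hx y hy
          rcases List.mem_cons.1 hd with rfl | hd
          · exact hu'orth x hx y (by simp [hv'sub y hy])
          · exact hMR d hd x (by simp [hu'sub x hx]) y hy
        · intro d hd x hx y hy
          exact hMR d hd x (by simp [hv'sub x hx]) y hy
      · intro x hx
        have := hmem x (hsub x (by rw [List.flatten_cons]; exact List.mem_append_right _ hx))
        simp only [List.flatten_cons, List.mem_append] at this ⊢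
        rcases this with ((h | h) | h) | h
        · exact Or.inl (hu'mem x hx h)
        · obtain ⟨d, hd, hxd⟩ := List.mem_flatten.1 hx
          exact absurd (hcA d hd x h x hxd) (h0 x)
        · exact Or.inr (Or.inl (hv'mem x hx h))
        · exact Or.inr (Or.inr h)

end Grow

/-! ### Duals by Riemenschneider's point rule -/

/-- Concatenation of two weight sequences, merging the last weight `p` of the first and the
first weight `q` of the second into `p + q - 1`. -/
def join : List ℤ → List ℤ → List ℤ
  | [], Y => Y
  | [p], [] => [p]
  | [p], q :: Y => (p + q - 1) :: Y
  | p :: p' :: X, Y => p :: join (p' :: X) Y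

theorem join_cons_cons (p p' : ℤ) (X Y : List ℤ) :
    join (p :: p' :: X) Y = p :: join (p' :: X) Y := by
  rw [join]

theorem join_nil (X : List ℤ) : join X [] = X := by
  induction X with
  | nil => rfl
  | cons p X ih =>
    cases X with
    | nil => rfl
    | cons p' X => rw [join_cons_cons, ih]

theorem join_concat_cons (X : List ℤ) (p q : ℤ) (Y : List ℤ) :
    join (X ++ [p]) (q :: Y) = X ++ (p + q - 1) :: Y := by
  induction X with
  | nil => rfl
  | cons x X ih =>
    cases X with
    | nil => rfl
    | cons x' X =>
      simp only [List.cons_append] at ih ⊢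
      rw [join_cons_cons, ih]

theorem join_append (X : List ℤ) {Y : List ℤ} (hY : Y ≠ []) (Z : List ℤ) :
    join (X ++ Y) Z = X ++ join Y Z := by
  obtain ⟨y, Y, rfl⟩ := List.exists_cons_of_ne_nil hY
  induction X with
  | nil => rfl
  | cons x X ih =>
    cases X with
    | nil => exact join_cons_cons ..
    | cons x' X =>
      simp only [List.cons_append] at ih ⊢
      rw [join_cons_cons, ih]

theorem join_assoc (X Y Z : List ℤ) : join (join X Y) Z = join X (join Y Z) := by
  rcases List.eq_nil_or_concat X with rfl | ⟨X, p, rfl⟩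
  · rfl
  cases Y with
  | nil => rw [join_nil]; rfl
  | cons q Y =>
    rw [List.concat_eq_append, join_concat_cons, join_append _ (by simp)]
    cases Y with
    | nil =>
      cases Z with
      | nil => rw [join_nil, join_nil, join_concat_cons]
      | cons z Z =>
        simp only [join]
        rw [join_concat_cons]
        congr 2
        ring
    | cons y Y => rw [join_cons_cons, join_cons_cons, join_concat_cons]

theorem reverse_join (X Y : List ℤ) : (join X Y).reverse = join Y.reverse X.reverse := by
  rcases List.eq_nil_or_concat X with rfl | ⟨X, p, rfl⟩
  · rw [List.reverse_nil, join_nil]; rfl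
  cases Y with
  | nil => rw [join_nil]; rfl
  | cons q Y =>
    rw [List.concat_eq_append, join_concat_cons]
    simp only [List.reverse_append, List.reverse_cons, List.append_assoc, List.reverse_nil,
      List.nil_append, List.singleton_append]
    rw [join_concat_cons, add_comm q p]

theorem join_eq_nil {X Y : List ℤ} : join X Y = [] ↔ X = [] ∧ Y = [] := by
  rcases List.eq_nil_or_concat X with rfl | ⟨X, p, rfl⟩
  · simp [join]
  cases Y with
  | nil => simp [join_nil]
  | cons q Y => simp [List.concat_eq_append, join_concat_cons]

theorem two_le_of_mem_join {X Y : List ℤ} (hX : ∀ x ∈ X, 2 ≤ x) (hY : ∀ y ∈ Y, 2 ≤ y) :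
    ∀ z ∈ join X Y, 2 ≤ z := by
  rcases List.eq_nil_or_concat X with rfl | ⟨X, p, rfl⟩
  · exact hY
  cases Y with
  | nil => rwa [join_nil]
  | cons q Y =>
    rw [List.concat_eq_append] at hX ⊢
    rw [join_concat_cons]
    intro z hz
    have hp := hX p (by simp)
    have hq := hY q (by simp)
    rcases List.mem_append.1 hz with hz | hz
    · exact hX z (by simp [hz])
    · rcases List.mem_cons.1 hz with rfl | hz
      · omega
      · exact hY z (by simp [hz])

/-- The dual of a weight sequence. -/
def dual : List ℤ → List ℤ
  | [] => []
  | x :: l => join (List.replicate (x - 1).toNat 2) (dual l)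

theorem dual_append (l m : List ℤ) : dual (l ++ m) = join (dual l) (dual m) := by
  induction l with
  | nil => rfl
  | cons x l ih => rw [List.cons_append, dual, ih, dual, join_assoc]

theorem dual_reverse (l : List ℤ) : dual l.reverse = (dual l).reverse := by
  induction l with
  | nil => rfl
  | cons x l ih =>
    rw [List.reverse_cons, dual_append, ih, dual, dual, dual, join_nil, reverse_join,
      List.reverse_replicate]

theorem dual_eq_nil {l : List ℤ} (hl : ∀ x ∈ l, 2 ≤ x) : dual l = [] ↔ l = [] := by
  cases l with
  | nil => simp [dual]
  | cons x l =>
    have := hl x (by simp)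
    rw [dual, join_eq_nil, List.replicate_eq_nil_iff]
    simp only [reduceCtorEq, iff_false, not_and]
    omega

theorem two_le_of_mem_dual (l : List ℤ) : ∀ y ∈ dual l, 2 ≤ y := by
  induction l with
  | nil => simp [dual]
  | cons x l ih =>
    exact two_le_of_mem_join (fun y hy => (List.eq_of_mem_replicate hy).ge) ih

theorem one_lt_negCF {l : List ℤ} (hl : ∀ x ∈ l, 2 ≤ x) (hne : l ≠ []) : 1 < negCF l := by
  induction l with
  | nil => exact absurd rfl hne
  | cons x l ih =>
    have hx : (2 : ℚ) ≤ x := by exact_mod_cast hl x (by simp)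
    rw [negCF]
    rcases eq_or_ne l [] with rfl | h
    · simp only [negCF]; linarith [div_zero (1 : ℚ)]
    · have := ih (fun y hy => hl y (by simp [hy])) h
      have : 1 / negCF l < 1 := by rw [div_lt_one (by linarith)]; exact this
      linarith

theorem one_div_negCF_mem {l : List ℤ} (hl : ∀ x ∈ l, 2 ≤ x) :
    0 ≤ 1 / negCF l ∧ 1 / negCF l < 1 := by
  rcases eq_or_ne l [] with rfl | h
  · simp [negCF]
  · have := one_lt_negCF hl h
    exact ⟨by positivity, by rw [div_lt_one (by linarith)]; exact this⟩

theorem negCF_injOn {l m : List ℤ} (hl : ∀ x ∈ l, 2 ≤ x) (hm : ∀ x ∈ m, 2 ≤ x)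
    (h : negCF l = negCF m) : l = m := by
  induction l generalizing m with
  | nil =>
    by_contra hne
    have := one_lt_negCF hm (Ne.symm hne)
    rw [← h, negCF] at this
    linarith
  | cons x l ih =>
    cases m with
    | nil =>
      have := one_lt_negCF hl (by simp)
      rw [h, negCF] at this
      linarith
    | cons y m =>
      have hl' : ∀ x ∈ l, 2 ≤ x := fun z hz => hl z (by simp [hz])
      have hm' : ∀ x ∈ m, 2 ≤ x := fun z hz => hm z (by simp [hz])
      obtain ⟨h1, h2⟩ := one_div_negCF_mem hl'
      obtain ⟨h3, h4⟩ := one_div_negCF_mem hm'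
      simp only [negCF] at h
      have h5 : (x : ℚ) < y + 1 := by linarith
      have h6 : (y : ℚ) < x + 1 := by linarith
      have hxy : x = y := by
        have h5' : x < y + 1 := by exact_mod_cast h5
        have h6' : y < x + 1 := by exact_mod_cast h6
        omega
      subst hxy
      have : 1 / negCF l = 1 / negCF m := by linarith
      rw [one_div, one_div, inv_inj] at this
      rw [ih hl' hm' this]

theorem one_div_negCF_join_replicate {Z : List ℤ} {s : ℚ} (hs : s < 1)
    (hnil : Z = [] → s = 0) (hZ : Z ≠ [] → 1 / negCF Z = 1 - s) (t : ℕ) :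
    1 / negCF (join (List.replicate (t + 1) 2) Z) = 1 - 1 / (t + 2 - s) := by
  induction t with
  | zero =>
    cases Z with
    | nil => norm_num [hnil rfl, join, negCF]
    | cons q Z =>
      have h := hZ (by simp)
      have hne : negCF (q :: Z) = 1 / (1 - s) := by rw [← h, one_div_one_div]
      have h1 : negCF (join (List.replicate (0 + 1) 2) (q :: Z)) = 1 + negCF (q :: Z) := by
        simp only [zero_add, List.replicate_one, join, negCF]
        push_cast
        ring
      rw [h1, hne]
      have h2 : 1 - s ≠ 0 := by linarith
      have h3 : 2 - s ≠ 0 := by linarith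
      have h4 : 1 + 1 / (1 - s) = (2 - s) / (1 - s) := by
        field_simp
        ring
      rw [h4, one_div_div, Nat.cast_zero, zero_add]
      field_simp
      ring
  | succ t ih =>
    have h1 : join (List.replicate (t + 1 + 1) 2) Z
        = 2 :: join (List.replicate (t + 1) 2) Z := rfl
    rw [h1, negCF, ih]
    have h0 : (0 : ℚ) ≤ t := by positivity
    have : (t : ℚ) + 2 - s ≠ 0 := by linarith
    have : (t : ℚ) + 1 + 2 - s ≠ 0 := by linarith
    have : (2 : ℚ) - (1 - 1 / (t + 2 - s)) = (t + 1 + 2 - s) / (t + 2 - s) := by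
      field_simp
      ring
    push_cast
    rw [this]
    field_simp
    ring

theorem one_div_negCF_dual {l : List ℤ} (hl : ∀ x ∈ l, 2 ≤ x) (hne : l ≠ []) :
    1 / negCF (dual l) = 1 - 1 / negCF l := by
  induction l with
  | nil => exact absurd rfl hne
  | cons x l ih =>
    have hl' : ∀ x ∈ l, 2 ≤ x := fun z hz => hl z (by simp [hz])
    obtain ⟨t, ht⟩ := Int.eq_ofNat_of_zero_le (sub_nonneg.2 (hl x (by simp)))
    obtain rfl : x = t + 2 := by omega
    have h1 : ((t : ℤ) + 2 - 1).toNat = t + 1 := by omega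
    rw [dual, h1, one_div_negCF_join_replicate (s := 1 / negCF l) (one_div_negCF_mem hl').2]
    · rw [negCF]; push_cast; rfl
    · intro h
      rw [(dual_eq_nil hl').1 h]
      simp [negCF]
    · intro h
      exact ih hl' fun h' => h ((dual_eq_nil hl').2 h')

theorem DualSeqs.eq_dual {a b : List ℤ} (h : DualSeqs a b) : b = dual a := by
  obtain ⟨ha, -, ha2, hb2, p, q, hq, hpq, -, hpa, hpb⟩ := h
  refine negCF_injOn hb2 (two_le_of_mem_dual a) ?_
  rw [← inv_inj, ← one_div, ← one_div, one_div_negCF_dual ha2 ha, hpa, hpb]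
  have hp : (p : ℚ) ≠ 0 := by exact_mod_cast (by omega : p ≠ 0)
  rw [one_div_div, one_div_div]
  field_simp

/-! ### Lists of chains of vectors in `ℤ^N` -/

/-- The disjoint union of paths with weights `Q` embeds into `ℤ^N`. -/
def Emb (N : ℕ) (Q : List (List ℤ)) : Prop :=
  ∃ W : List (List (Fin N → ℤ)), Rep dot W ∧ W.map (List.map fun x => dot x x) = Q

section dot

variable {N : ℕ} (x y z : Fin N → ℤ)

theorem dot_comm : dot x y = dot y x := by simp only [dot, mul_comm]

theorem dot_add : dot x (y + z) = dot x y + dot x z := by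
  simp only [dot, Pi.add_apply, mul_add, Finset.sum_add_distrib]

theorem add_dot : dot (x + y) z = dot x z + dot y z := by
  rw [dot_comm, dot_add, dot_comm z x, dot_comm z y]

theorem zero_dot : dot 0 y = 0 := by simp [dot]

theorem dot_snoc (a b : ℤ) :
    dot (Fin.snoc x a : Fin (N + 1) → ℤ) (Fin.snoc y b : Fin (N + 1) → ℤ)
      = dot x y + a * b := by
  simp [dot, Fin.sum_univ_castSucc]

end dot

theorem Emb.perm {N : ℕ} {Q Q' : List (List ℤ)} (hQ : Q.Perm Q') (h : Emb N Q) : Emb N Q' := by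
  obtain ⟨W, hW, rfl⟩ := h
  obtain ⟨W', rfl, h⟩ :=
    (congr_fun₂ (List.eq_map_comp_perm (List.map fun x : Fin N → ℤ => dot x x)) Q' W).mpr hQ.symm
  exact ⟨W', hW.perm dot_comm h.symm, rfl⟩

theorem Emb.reverse {N : ℕ} {q : List ℤ} {Q : List (List ℤ)} (h : Emb N (q :: Q)) :
    Emb N (q.reverse :: Q) := by
  obtain ⟨W, hW, h⟩ := h
  obtain ⟨c, W, rfl, rfl, rfl⟩ := List.map_eq_cons_iff.1 h
  rw [rep_cons] at hW
  refine ⟨c.reverse :: W, rep_cons.2 ⟨hW.1.reverse dot_comm, ?_, hW.2.2⟩, by simp⟩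
  exact fun d hd x hx => hW.2.1 d hd x (by simpa using hx)

theorem emb_nil_cons {N : ℕ} {Q : List (List ℤ)} : Emb N ([] :: Q) ↔ Emb N Q := by
  constructor
  · rintro ⟨W, hW, h⟩
    obtain ⟨c, W, rfl, -, rfl⟩ := List.map_eq_cons_iff.1 h
    exact ⟨W, (rep_cons.1 hW).2.2, rfl⟩
  · rintro ⟨W, hW, rfl⟩
    exact ⟨[] :: W, rep_cons.2 ⟨trivial, by simp [Orth], hW⟩, rfl⟩

theorem dot_snoc_zero {N : ℕ} (x y : Fin N → ℤ) :
    dot (Fin.snoc x 0 : Fin (N + 1) → ℤ) (Fin.snoc y 0 : Fin (N + 1) → ℤ) = dot x y := by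
  rw [dot_snoc]; simp

theorem Emb.cons_one {N : ℕ} {Q : List (List ℤ)} (h : Emb N Q) : Emb (N + 1) ([1] :: Q) := by
  obtain ⟨W, hW, rfl⟩ := h
  refine ⟨[Fin.snoc 0 1] :: W.map (List.map fun x => Fin.snoc x 0), rep_cons.2 ⟨?_, ?_,
    hW.map dot_snoc_zero⟩, ?_⟩
  · exact ⟨trivial, trivial⟩
  · intro d hd x hx y hy
    obtain ⟨d, hd, rfl⟩ := List.mem_map.1 hd
    obtain ⟨y, hy, rfl⟩ := List.mem_map.1 hy
    obtain rfl := List.mem_singleton.1 hx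
    rw [dot_snoc, zero_dot]
    simp
  · simp [dot_snoc, zero_dot, Function.comp_def]

theorem Emb.extend {N : ℕ} {q : ℤ} {Y : List ℤ} {Q : List (List ℤ)}
    (h : Emb N ((q :: Y) :: Q)) : Emb (N + 1) ((1 :: (q + 1) :: Y) :: Q) := by
  obtain ⟨W, hW, h⟩ := h
  obtain ⟨c, W, rfl, h', rfl⟩ := List.map_eq_cons_iff.1 h
  obtain ⟨x, c, rfl, rfl, rfl⟩ := List.map_eq_cons_iff.1 h'
  have hm := rep_cons.1 (hW.map (B' := dot) dot_snoc_zero)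
  refine ⟨(Fin.snoc 0 (-1) :: Fin.snoc x 1 :: c.map fun x => Fin.snoc x 0) ::
    W.map (List.map fun x => Fin.snoc x 0), rep_cons.2 ⟨⟨⟨?_, ?_⟩, ?_⟩, ?_, hm.2.2⟩, ?_⟩
  · rw [dot_snoc, zero_dot]; simp
  · intro y hy
    obtain ⟨y, hy, rfl⟩ := List.mem_map.1 hy
    rw [dot_snoc, zero_dot]; simp
  · refine hm.1.congr_head fun b hb => ?_
    obtain ⟨y, hy, rfl⟩ := List.mem_map.1 hb
    simp [dot_snoc]
  · intro d hd z hz y hy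
    have h1 := hm.2.1 d hd
    obtain ⟨d, hd, rfl⟩ := List.mem_map.1 hd
    obtain ⟨y', hy', rfl⟩ := List.mem_map.1 hy
    rcases List.mem_cons.1 hz with rfl | hz
    · rw [dot_snoc, zero_dot]; simp
    · rcases List.mem_cons.1 hz with rfl | hz
      · have := h1 (Fin.snoc x 0) (by simp) _ hy
        rw [dot_snoc] at this ⊢
        simpa using this
      · exact h1 z (List.mem_cons_of_mem _ hz) _ hy
  · simp [dot_snoc, zero_dot, Function.comp_def]

theorem Emb.merge {N : ℕ} {X Y : List ℤ} {p q : ℤ} {Q : List (List ℤ)}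
    (h : Emb N ((X ++ [p]) :: (q :: Y) :: Q)) : Emb N ((X ++ (p + q) :: Y) :: Q) := by
  obtain ⟨W, hW, h⟩ := h
  obtain ⟨c, W, rfl, h1, h'⟩ := List.map_eq_cons_iff.1 h
  obtain ⟨d, W, rfl, h2, rfl⟩ := List.map_eq_cons_iff.1 h'
  obtain ⟨X, c, rfl, rfl, h3⟩ := List.map_eq_append_iff.1 h1
  obtain ⟨x, c, rfl, rfl, h4⟩ := List.map_eq_cons_iff.1 h3
  obtain rfl := List.map_eq_nil_iff.1 h4
  obtain ⟨y, Y, rfl, rfl, rfl⟩ := List.map_eq_cons_iff.1 h2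
  obtain ⟨hc, hcW, hW⟩ := rep_cons.1 hW
  obtain ⟨hd, hdW, hW⟩ := rep_cons.1 hW
  have hcd := hcW _ (List.mem_cons_self ..)
  refine ⟨(X ++ (x + y) :: Y) :: W, rep_cons.2 ⟨?_, ?_, hW⟩, ?_⟩
  · rw [lin_append]
    refine ⟨hc.congr_last fun a ha => ?_, hd.congr_head fun b hb => ?_, fun a ha b hb => ?_⟩
    · rw [dot_add, hcd a (by simp [ha]) y (by simp), add_zero]
    · rw [add_dot, hcd x (by simp) b (by simp [hb]), zero_add]
    · exact hcd a (by simp [ha]) b (by simp [hb])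
  · intro d hd z hz w hw
    have h1 := hcW d (List.mem_cons_of_mem _ hd)
    have h2 := hdW d hd
    rcases List.mem_append.1 hz with hz | hz
    · exact h1 z (by simp [hz]) w hw
    · rcases List.mem_cons.1 hz with rfl | hz
      · rw [add_dot, h1 x (by simp) w hw, h2 y (by simp) w hw, add_zero]
      · exact h2 z (by simp [hz]) w hw
  · have h1 := hcd x (by simp) y (by simp)
    simp [dot_add, add_dot, h1, dot_comm y x]

theorem Emb.join_replicate {N : ℕ} {Z : List ℤ} {Q : List (List ℤ)} (h : Emb N (Z :: Q))
    (t : ℕ) : ∃ N' q Y, Emb N' ((q :: Y) :: Q) ∧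
      join (List.replicate (t + 1) 2) Z = (q + 1) :: Y ∧
      N' + Z.length = N + t + (Y.length + 1 - t) ∧ t ≤ Y.length := by
  induction t with
  | zero =>
    cases Z with
    | nil => exact ⟨N + 1, 1, [], (emb_nil_cons.1 h).cons_one, rfl, rfl, le_rfl⟩
    | cons q Y =>
      refine ⟨N, q, Y, h, ?_, rfl, Nat.zero_le _⟩
      simp only [zero_add, List.replicate_one, join]
      congr 1
      ring
  | succ t ih =>
    obtain ⟨N', q, Y, h1, h2, h3, h4⟩ := ih
    refine ⟨N' + 1, 1, (q + 1) :: Y, h1.extend, ?_, ?_, by simpa using h4⟩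
    · rw [← h2]; rfl
    · simp only [List.length_cons]; omega

theorem Emb.insert {N : ℕ} {X Y : List ℤ} {Q : List (List ℤ)} (h : Emb N (X :: Y :: Q))
    (t : ℕ) : ∃ N', Emb N' (join X (join (List.replicate (t + 1) 2) Y) :: Q) ∧
      N' + X.length + Y.length
        = N + (join X (join (List.replicate (t + 1) 2) Y)).length + 1 := by
  obtain ⟨N', q, Z, h1, h2, h3, h4⟩ := (h.perm (List.Perm.swap _ _ _)).join_replicate t
  have h5 := h1.perm ((List.Perm.swap _ _ _) : List.Perm ((q :: Z) :: X :: Q) _)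
  rw [h2]
  rcases List.eq_nil_or_concat X with rfl | ⟨X, p, rfl⟩
  · refine ⟨N' + 1, ?_, ?_⟩
    · rw [add_comm q 1]
      exact Emb.merge (X := []) (emb_nil_cons.1 h5).cons_one
    · simp only [join, List.length_cons, List.length_nil]; omega
  · rw [List.concat_eq_append] at h5 ⊢
    rw [join_concat_cons]
    refine ⟨N', ?_, ?_⟩
    · have := h5.merge
      rwa [show p + (q + 1) - 1 = p + q by ring]
    · simp only [List.length_append, List.length_cons, List.length_nil]; omega

/-! ### Failing Property `X_k` -/

/-- The list of duals of a list of paths with negative weights. -/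
def dualList (P : List (List ℤ)) : List (List ℤ) := P.map fun c => dual (c.map fun x => -x)

theorem IsDualPair.eq_dualList {P D : List (List ℤ)} (h : IsDualPair P D) : D = dualList P := by
  obtain ⟨hlen, h⟩ := h
  refine List.ext_getElem (by simp [dualList, hlen]) fun i h1 h2 => ?_
  simpa [dualList] using (h ⟨i, hlen ▸ h1⟩).eq_dual

/-- The weight sequences `P` fail Property `X_k`. -/
def FailsDual (k : ℕ) (P : List (List ℤ)) : Prop :=
  ∃ N, N + k = totalLen P + totalLen (dualList P) ∧ Emb N (dualList P)

theorem totalLen_perm {L L' : List (List ℤ)} (h : L.Perm L') : totalLen L = totalLen L' :=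
  (h.map _).sum_eq

theorem totalLen_cons (c : List ℤ) (L : List (List ℤ)) :
    totalLen (c :: L) = c.length + totalLen L := by simp [totalLen]

theorem dualList_cons (c : List ℤ) (L : List (List ℤ)) :
    dualList (c :: L) = dual (c.map fun x => -x) :: dualList L := rfl

theorem growClosed_failsDual {V : Type*} {w : V → ℤ} (hw : ∀ v, w v ≤ -2) (k : ℕ) :
    GrowClosed fun A : List (List V) => FailsDual k (A.map (List.map w)) where
  perm := by
    rintro A A' h ⟨N, hN, hE⟩
    have h1 := h.map (List.map w)
    have h2 := h1.map fun c => dual (c.map fun x => -x)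
    exact ⟨N, by rw [hN, totalLen_perm h1]; exact congrArg _ (totalLen_perm h2), hE.perm h2⟩
  reverse := by
    rintro c A ⟨N, hN, hE⟩
    rw [List.map_cons, dualList_cons] at hE
    refine ⟨N, ?_, ?_⟩
    · simpa only [List.map_cons, dualList_cons, totalLen_cons, List.map_reverse, dual_reverse,
        List.length_reverse] using hN
    · simpa only [List.map_cons, dualList_cons, List.map_reverse, dual_reverse] using hE.reverse
  nil_iff := by
    intro A
    simp [FailsDual, dualList_cons, totalLen_cons, dual, emb_nil_cons]
  insert := by
    rintro u x v A ⟨N, hN, hE⟩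
    simp only [List.map_cons, dualList_cons, totalLen_cons] at hN hE
    obtain ⟨t, ht⟩ := Int.eq_ofNat_of_zero_le (by linarith [hw x] : 0 ≤ -w x - 2)
    have hx : (-w x - 1).toNat = t + 1 := by omega
    obtain ⟨N', hE', hN'⟩ := hE.insert t
    refine ⟨N', ?_, ?_⟩
    · simp only [List.map_cons, List.map_append, dualList_cons, totalLen_cons, dual_append,
        dual, hx, List.length_append, List.length_cons]
      omega
    · simpa only [List.map_cons, List.map_append, dualList_cons, dual_append, dual, hx] using hE'

/-! ### Families indexed by the vertices of a configuration -/

section toLists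

variable {T T' : Type*}

/-- The list of lists of values of a function on the vertices of `ofList L`. -/
def toLists (L : List (List ℤ)) (φ : (ofList L).V → T) : List (List T) :=
  List.ofFn fun i : Fin L.length => List.ofFn fun j : Fin (L.get i).length => φ ⟨i, j⟩

theorem map_toLists (L : List (List ℤ)) (φ : (ofList L).V → T) (g : T → T') :
    (toLists L φ).map (List.map g) = toLists L fun v => g (φ v) := by
  simp only [toLists, List.map_ofFn, Function.comp_def]

theorem toLists_w (L : List (List ℤ)) : toLists L (ofList L).w = L := by
  simp only [toLists, ofList, List.ofFn_get]

theorem mem_flatten_toLists {L : List (List ℤ)} {φ : (ofList L).V → T} {x : T} :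
    x ∈ (toLists L φ).flatten ↔ ∃ v, φ v = x := by
  simp only [toLists, List.mem_flatten, List.mem_ofFn]
  constructor
  · rintro ⟨-, ⟨i, rfl⟩, hx⟩
    obtain ⟨j, rfl⟩ := List.mem_ofFn.1 hx
    exact ⟨_, rfl⟩
  · rintro ⟨⟨i, j⟩, rfl⟩
    exact ⟨_, ⟨i, rfl⟩, List.mem_ofFn.2 ⟨j, rfl⟩⟩

/-- The prescribed Gram matrix of an embedding of `ofList L`. -/
def gram (L : List (List ℤ)) (u v : (ofList L).V) : ℤ :=
  if u = v then (ofList L).w u else if (ofList L).graph.Adj u v then -1 else 0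

theorem gram_self (L : List (List ℤ)) (u : (ofList L).V) : gram L u u = (ofList L).w u :=
  if_pos rfl

theorem gram_comm (L : List (List ℤ)) (u v : (ofList L).V) : gram L u v = gram L v u := by
  by_cases h : u = v
  · rw [h]
  · simp [gram, h, Ne.symm h, (ofList L).graph.adj_comm u v]

theorem gram_of_lt {L : List (List ℤ)} {i : Fin L.length} {a b : Fin (L.get i).length}
    (hab : a < b) : gram L ⟨i, a⟩ ⟨i, b⟩ = if (a : ℕ) + 1 = b then -1 else 0 := by
  have hne : (⟨i, a⟩ : (i : Fin L.length) × Fin (L.get i).length) ≠ ⟨i, b⟩ :=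
    fun he => hab.ne (eq_of_heq (Sigma.mk.inj he).2)
  refine (if_neg hne).trans ?_
  by_cases h : (a : ℕ) + 1 = b
  · rw [if_pos h]
    exact if_pos ⟨rfl, Or.inl h⟩
  · rw [if_neg h]
    refine if_neg fun hadj => ?_
    rcases hadj.2 with h' | h'
    · exact h h'
    · have h1 : (b : ℕ) + 1 = a := h'
      have h2 : (a : ℕ) < b := hab
      omega

theorem gram_of_ne {L : List (List ℤ)} {i j : Fin L.length} (hij : i ≠ j)
    (a : Fin (L.get i).length) (b : Fin (L.get j).length) : gram L ⟨i, a⟩ ⟨j, b⟩ = 0 := by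
  have hne : (⟨i, a⟩ : (i : Fin L.length) × Fin (L.get i).length) ≠ ⟨j, b⟩ :=
    fun he => hij (Sigma.mk.inj he).1
  exact (if_neg hne).trans (if_neg fun hadj => hij hadj.1)

theorem rep_toLists {B : T → T → ℤ} {L : List (List ℤ)} {φ : (ofList L).V → T}
    (h : ∀ u v, B (φ u) (φ v) = gram L u v) : Rep B (toLists L φ) := by
  constructor
  · intro c hc
    obtain ⟨i, rfl⟩ := List.mem_ofFn.1 hc
    rw [lin_iff_getElem]
    intro a b ha hb hab
    rw [List.getElem_ofFn, List.getElem_ofFn]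
    exact (h _ _).trans (gram_of_lt hab)
  · rw [toLists, List.pairwise_ofFn]
    intro i j hij x hx y hy
    obtain ⟨a, rfl⟩ := List.mem_ofFn.1 hx
    obtain ⟨b, rfl⟩ := List.mem_ofFn.1 hy
    exact (h _ _).trans (gram_of_ne hij.ne a b)

theorem emb_iff {N : ℕ} {D : List (List ℤ)} :
    Emb N D ↔ ∃ φ, (ofList D).IsEmbedding N φ := by
  constructor
  · rintro ⟨W, hW, rfl⟩
    set D := W.map (List.map fun x => dot x x)
    have hi (i : Fin D.length) : (i : ℕ) < W.length := by simpa [D] using i.2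
    have hj (i : Fin D.length) (j : Fin (D.get i).length) : (j : ℕ) < (W[i]'(hi i)).length := by
      simpa [D] using j.2
    have hlin (i : Fin D.length) := lin_iff_getElem.1 (hW.1 _ (List.getElem_mem (hi i)))
    have horth := List.pairwise_iff_getElem.1 hW.2
    refine ⟨fun v => (W[v.1]'(hi v.1))[v.2]'(hj v.1 v.2), ?_⟩
    rintro ⟨i, a⟩ ⟨i', b⟩
    by_cases hii : i = i'
    · subst hii
      rcases lt_trichotomy a b with hlt | rfl | hlt
      · exact (hlin i a b (hj i a) (hj i b) hlt).trans (gram_of_lt hlt).symm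
      · refine Eq.trans ?_ (gram_self D _).symm
        simp [ofList, D]
      · refine (dot_comm _ _).trans (Eq.trans ?_ (gram_comm D _ _))
        exact (hlin i b a (hj i b) (hj i a) hlt).trans (gram_of_lt hlt).symm
    · refine Eq.trans ?_ (gram_of_ne hii a b).symm
      rcases lt_or_gt_of_ne fun h => hii (Fin.ext h) with hlt | hlt
      · exact horth i i' (hi i) (hi i') hlt _ (List.getElem_mem _) _ (List.getElem_mem _)
      · refine (dot_comm _ _).trans ?_
        exact horth i' i (hi i') (hi i) hlt _ (List.getElem_mem _) _ (List.getElem_mem _)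
  · rintro ⟨φ, hφ⟩
    refine ⟨toLists D φ, rep_toLists hφ, ?_⟩
    rw [map_toLists]
    have : (fun v => dot (φ v) (φ v)) = (ofList D).w := by
      funext v
      exact (hφ v v).trans (gram_self D v)
    rw [this, toLists_w]

end toLists

theorem failsX_iff {k : ℕ} {P D : List (List ℤ)} (h : IsDualPair P D) :
    FailsX k P D ↔ FailsDual k P := by
  obtain rfl := h.eq_dualList
  rw [FailsX, ← emb_iff, FailsDual]
  constructor
  · rintro ⟨hk, hE⟩
    exact ⟨_, Nat.sub_add_cancel hk, hE⟩
  · rintro ⟨N, hN, hE⟩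
    refine ⟨by omega, ?_⟩
    rwa [← hN, Nat.add_sub_cancel]

theorem IsDualPair.w_le {P D : List (List ℤ)} (h : IsDualPair P D) (v : (ofList P).V) :
    (ofList P).w v ≤ -2 := by
  obtain ⟨_, h⟩ := h
  have := (h v.1).2.2.1 (-(ofList P).w v) (List.mem_map.2 ⟨_, List.get_mem _ v.2, rfl⟩)
  omega

/-- Lemma 6.1: failing Property `X_k` is inherited by canonical plumbing graphs
containing a failing one as an induced subgraph. -/
theorem statement14 (k : ℕ) (hk : 0 < k)
    (P D P' D' : List (List ℤ)) (hPD : IsDualPair P D) (hPD' : IsDualPair P' D')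
    (hsub : IsInducedSubgraph (ofList P) (ofList P'))
    (hfail : FailsX k P D) : FailsX k P' D' := by
  rw [failsX_iff hPD] at hfail
  rw [failsX_iff hPD']
  obtain ⟨f, hf, hfw, hfadj⟩ := hsub
  have hw := hPD'.w_le
  have hB : ∀ u, gram P' u u ≤ -2 := fun u => (gram_self P' u).trans_le (hw u)
  have hA : Rep (gram P') (toLists P f) := rep_toLists fun u v => by
    simp only [gram, hf.eq_iff, hfw, hfadj]
  have hW : Rep (gram P') (toLists P' id) := rep_toLists fun u v => rfl
  have hPA : (toLists P f).map (List.map (ofList P').w) = P := by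
    rw [map_toLists, funext hfw, toLists_w]
  have hPW : (toLists P' id).map (List.map (ofList P').w) = P' :=
    (map_toLists _ _ _).trans (toLists_w P')
  have := hA.grow (growClosed_failsDual hw k) (gram_comm P') (fun u h => by linarith [hB u])
    (fun u h => by linarith [hB u]) hW (fun x _ => mem_flatten_toLists.2 ⟨x, rfl⟩) (C := [])
    (by rwa [List.append_nil, hPA])
  rwa [List.append_nil, hPW] at this

end LensPaper
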